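/- Let 1 ≤ l ≤ k and let u(x,t) = u_0(x − t) with u_0 : ℝ → ℝ of class C^{k+l+2}, so that u_t + u_x = 0. Then there is a constant C depending only on k, l and the quasi-uniformity constant c such that for every cell τ_j, every t ∈ [0,T], and every polynomial v of degree ≤ k, |a_j(u − u_I^l, v)| ≤ C h^{k+l+1} M_{k+l+2} ∫_{τ_j} |v| dx, where in a_j the trace (u − u_I^l)(x_{j-1/2}^-) is taken from the cell τ_{j−1} for j ≥ 2 and is set equal to 0 for j = 1. -/

import Mathlib

open MeasureTheory intervalIntegral

/-- Legendre polynomial of degree `m` via the Rodrigues formula. -/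
noncomputable def legendreP (m : ℕ) : ℝ → ℝ :=
  fun s => (1 / ((2:ℝ) ^ m * (Nat.factorial m : ℝ))) *
    iteratedDeriv m (fun t : ℝ => (t ^ 2 - 1) ^ m) s

/-- Legendre polynomial rescaled to the cell `(a, b)`. -/
noncomputable def legendreCell (m : ℕ) (a b : ℝ) : ℝ → ℝ :=
  fun x => legendreP m ((2 * x - (a + b)) / (b - a))

/-- `P` is the Gauss–Radau projection (onto polynomials of degree ≤ k on `(a,b)`) of `u`. -/
def IsGRProj (k : ℕ) (a b : ℝ) (u : ℝ → ℝ) (P : Polynomial ℝ) : Prop :=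
  P.natDegree ≤ k ∧
  (∀ v : Polynomial ℝ, v.natDegree + 1 ≤ k →
    (∫ x in a..b, P.eval x * v.eval x) = ∫ x in a..b, u x * v.eval x) ∧
  P.eval b = u b

/-- The scaled primitive `(D⁻¹ v)(x) = (2/(b-a)) ∫_a^x v`. -/
noncomputable def Dinv (a b : ℝ) (v : ℝ → ℝ) : ℝ → ℝ :=
  fun x => (2 / (b - a)) * ∫ t in a..x, v t

/-- `F` is the sequence of correction polynomials on the cell `(a,b)`:
`F 1 = P_h^-(D⁻¹ L_k)` and `F i = -P_h^-(D⁻¹ F (i-1))` for `i ≥ 2`. -/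
def IsFSeq (k : ℕ) (a b : ℝ) (F : ℕ → Polynomial ℝ) : Prop :=
  IsGRProj k a b (Dinv a b (legendreCell k a b)) (F 1) ∧
  ∀ i, 2 ≤ i → IsGRProj k a b (Dinv a b (fun x => (F (i-1)).eval x)) (-(F i))

/-- The `m`-th Radau coefficient of `w` on the cell `(a,b)`. -/
noncomputable def radauCoeff (a b : ℝ) (w : ℝ → ℝ) (m : ℕ) : ℝ :=
  w b - (1 / (b - a)) *
    ∫ x in a..b, w x * ∑ l ∈ Finset.range m, (2 * (l:ℝ) + 1) * legendreCell l a b x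

/-- `G_i(t) = (d/dt)^i u_{j,k+1}(t)` for `u(x,t) = u0(x - t)` on the cell `(a,b)`. -/
noncomputable def Gfun (k : ℕ) (a b : ℝ) (u0 : ℝ → ℝ) (i : ℕ) (t : ℝ) : ℝ :=
  iteratedDeriv i (fun s => radauCoeff a b (fun y => u0 (y - s)) (k + 1)) t

/-- `w_i(x,t) = (h_j/2)^i G_i(t) F_i(x)` on the cell `(a,b)`. -/
noncomputable def wFun (k : ℕ) (a b : ℝ) (u0 : ℝ → ℝ) (F : ℕ → Polynomial ℝ)
    (i : ℕ) (y t : ℝ) : ℝ :=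
  ((b - a) / 2) ^ i * Gfun k a b u0 i t * (F i).eval y

/-- `w^l = Σ_{i=1}^l w_i` on the cell `(a,b)`. -/
noncomputable def wSum (k : ℕ) (a b : ℝ) (u0 : ℝ → ℝ) (F : ℕ → Polynomial ℝ)
    (l : ℕ) (y t : ℝ) : ℝ :=
  ∑ i ∈ Finset.Icc 1 l, wFun k a b u0 F i y t

/-- The interpolation function `u_I^l = P_h^- u - w^l` on the cell `(a,b)`;
here `P t` is the Gauss–Radau projection of `u(·,t)`. -/
noncomputable def uIl (k : ℕ) (a b : ℝ) (u0 : ℝ → ℝ) (P : ℝ → Polynomial ℝ)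
    (F : ℕ → Polynomial ℝ) (l : ℕ) (y t : ℝ) : ℝ :=
  (P t).eval y - wSum k a b u0 F l y t

/-- `uh` is a DG solution on `[0,T]` on the mesh `x 0 < x 1 < … < x N`
(the piece on the cell `τ_j = (x (j-1), x j)` is the polynomial `uh j t`),
with prescribed inflow value `inflow t` at the left boundary. -/
def IsDGSol (k N : ℕ) (x : ℕ → ℝ) (T : ℝ) (inflow : ℝ → ℝ)
    (uh : ℕ → ℝ → Polynomial ℝ) : Prop :=
  (∀ j ∈ Finset.Icc 1 N, ∀ t : ℝ, (uh j t).natDegree ≤ k) ∧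
  (∀ j ∈ Finset.Icc 1 N, ∀ y : ℝ, ContDiff ℝ 1 (fun t => (uh j t).eval y)) ∧
  (∀ j ∈ Finset.Icc 1 N, ∀ t ∈ Set.Icc (0:ℝ) T, ∀ v : Polynomial ℝ, v.natDegree ≤ k →
    (∫ y in (x (j-1))..(x j), deriv (fun s => (uh j s).eval y) t * v.eval y)
      - (∫ y in (x (j-1))..(x j), (uh j t).eval y * v.derivative.eval y)
      + (uh j t).eval (x j) * v.eval (x j)
      - (if j = 1 then inflow t else (uh (j-1) t).eval (x (j-1))) * v.eval (x (j-1)) = 0)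

/-- The error `u - u_I^l` on the cell `τ_j`, as a function of `(y, s)`. -/
noncomputable def errFun (k l : ℕ) (x : ℕ → ℝ) (u0 : ℝ → ℝ)
    (P : ℕ → ℝ → Polynomial ℝ) (F : ℕ → ℕ → Polynomial ℝ) (j : ℕ) (y s : ℝ) : ℝ :=
  u0 (y - s) - uIl k (x (j-1)) (x j) u0 (P j) (F j) l y s

open Polynomial in
/-- Legendre polynomial as an actual polynomial. -/
noncomputable def legQ (m : ℕ) : Polynomial ℝ :=
  C (1 / ((2:ℝ) ^ m * (Nat.factorial m : ℝ))) * derivative^[m] ((X ^ 2 - 1) ^ m)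

open Polynomial in
lemma iteratedDeriv_poly (p : ℝ[X]) (m : ℕ) :
    iteratedDeriv m (fun t => p.eval t) = fun t => (derivative^[m] p).eval t := by
  induction m with
  | zero => simp
  | succ n ih =>
    rw [iteratedDeriv_succ, ih, Function.iterate_succ_apply']
    funext t
    simp

open Polynomial in
lemma legQ_eval (m : ℕ) (s : ℝ) : (legQ m).eval s = legendreP m s := by
  have := congrFun (iteratedDeriv_poly ((X ^ 2 - 1) ^ m) m) s
  simp only [eval_pow, eval_sub, eval_X, eval_one] at this
  rw [legendreP, legQ, this]
  simp

open Polynomial in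
lemma legQ_natDegree (m : ℕ) : (legQ m).natDegree ≤ m := by
  unfold legQ
  refine (natDegree_C_mul_le _ _).trans ?_
  refine (natDegree_iterate_derivative _ _).trans ?_
  have h1 : ((X ^ 2 - 1 : ℝ[X]) ^ m).natDegree ≤ m * 2 := by
    refine natDegree_pow_le_of_le m ?_
    compute_degree
  omega

open Polynomial in
lemma legQ_one (m : ℕ) : (legQ m).eval 1 = 1 := by
  have h := aeval_iterate_derivative_self (A := ℝ) ((X ^ 2 - 1 : ℝ[X]) ^ m) m 1
    (p' := (X + 1) ^ m) (by
      simp only [Polynomial.map_pow, Polynomial.map_sub, map_X, Polynomial.map_one, C_1]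
      rw [← mul_pow]; congr 1; ring)
  simp only [coe_aeval_eq_eval, eval_pow, eval_add, eval_X, eval_one] at h
  unfold legQ
  rw [eval_mul, eval_C, h]
  have : (Nat.factorial m : ℝ) ≠ 0 := by positivity
  simp only [nsmul_eq_mul]
  field_simp
  norm_num

open Polynomial in
lemma legQ_neg_one_sq (m : ℕ) : (legQ m).eval (-1) ^ 2 = 1 := by
  have h := aeval_iterate_derivative_self (A := ℝ) ((X ^ 2 - 1 : ℝ[X]) ^ m) m (-1)
    (p' := (X - 1) ^ m) (by
      simp only [Polynomial.map_pow, Polynomial.map_sub, map_X, Polynomial.map_one, C_1, C_neg]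
      rw [← mul_pow]; congr 1; ring)
  simp only [coe_aeval_eq_eval, eval_pow, eval_sub, eval_X, eval_one] at h
  unfold legQ
  rw [eval_mul, eval_C, h]
  have : (Nat.factorial m : ℝ) ≠ 0 := by positivity
  simp only [nsmul_eq_mul]
  field_simp
  rw [← pow_mul, ← pow_mul, mul_comm m 2, pow_mul, pow_mul]
  norm_num

lemma poly_ii (p : Polynomial ℝ) (a b : ℝ) : IntervalIntegrable (fun x => p.eval x) volume a b :=
  p.continuous.intervalIntegrable a b

open Polynomial in
/-- integration by parts for polynomials -/
lemma poly_ibp (p q : ℝ[X]) (a b : ℝ) :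
    (∫ x in a..b, (derivative p).eval x * q.eval x) =
      p.eval b * q.eval b - p.eval a * q.eval a - ∫ x in a..b, p.eval x * (derivative q).eval x := by
  rw [intervalIntegral.integral_mul_deriv_eq_deriv_mul (u := fun x => p.eval x)
    (v := fun x => q.eval x) (u' := fun x => (derivative p).eval x)
    (fun x _ => p.hasDerivAt x) (fun x _ => q.hasDerivAt x) (poly_ii _ _ _) (poly_ii _ _ _)]
  ring

open Polynomial in
lemma rodrigues_zero (m j : ℕ) (hj : j < m) :
    (derivative^[j] ((X ^ 2 - 1 : ℝ[X]) ^ m)).eval 1 = 0 ∧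
    (derivative^[j] ((X ^ 2 - 1 : ℝ[X]) ^ m)).eval (-1) = 0 := by
  constructor
  · have h := aeval_iterate_derivative_of_lt (A := ℝ) ((X ^ 2 - 1 : ℝ[X]) ^ m) m 1
      (p' := (X + 1) ^ m) (by
        simp only [Polynomial.map_pow, Polynomial.map_sub, map_X, Polynomial.map_one, C_1]
        rw [← mul_pow]; congr 1; ring) hj
    simpa using h
  · have h := aeval_iterate_derivative_of_lt (A := ℝ) ((X ^ 2 - 1 : ℝ[X]) ^ m) m (-1)
      (p' := (X - 1) ^ m) (by
        simp only [Polynomial.map_pow, Polynomial.map_sub, map_X, Polynomial.map_one, C_1, C_neg]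
        rw [← mul_pow]; congr 1; ring) hj
    simpa using h

open Polynomial in
lemma rodrigues_orth (m j : ℕ) (hj : j ≤ m) (v : ℝ[X]) (hv : v.degree < j) :
    (∫ x in (-1:ℝ)..1, (derivative^[j] ((X ^ 2 - 1 : ℝ[X]) ^ m)).eval x * v.eval x) = 0 := by
  induction j generalizing v with
  | zero =>
    have : v = 0 := by
      rw [← degree_eq_bot]
      simpa using hv
    simp [this]
  | succ n ih =>
    rw [Function.iterate_succ_apply', poly_ibp, (rodrigues_zero m n (by omega)).1,
      (rodrigues_zero m n (by omega)).2, ih (by omega)]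
    · simp
    · rw [degree_lt_iff_coeff_zero] at hv ⊢
      intro i hi
      rw [coeff_derivative, hv (i+1) (by omega)]; simp

open Polynomial in
lemma legQ_orth (m : ℕ) (v : ℝ[X]) (hv : v.degree < m) :
    (∫ x in (-1:ℝ)..1, (legQ m).eval x * v.eval x) = 0 := by
  unfold legQ
  simp only [eval_mul, eval_C, mul_assoc]
  rw [intervalIntegral.integral_const_mul, rodrigues_orth m m le_rfl v hv, mul_zero]

open Polynomial in
lemma legQ_norm (m : ℕ) :
    (2 * (m:ℝ) + 1) / 2 * (∫ x in (-1:ℝ)..1, (legQ m).eval x * (legQ m).eval x) = 1 := by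
  have h1 := poly_ibp (legQ m) (X * legQ m) (-1) 1
  have hr := legQ_orth m (X * derivative (legQ m) - C (m:ℝ) * legQ m) (by
    rw [degree_lt_iff_coeff_zero]
    intro i hi
    rw [coeff_sub, coeff_C_mul]
    rcases i with _ | i
    · have : m = 0 := by omega
      subst this
      simp
    · rw [coeff_X_mul, coeff_derivative]
      rcases Nat.lt_or_ge m (i+1) with h | h
      · rw [coeff_eq_zero_of_natDegree_lt (lt_of_le_of_lt (legQ_natDegree m) h)]; simp
      · have : m = i + 1 := by omega
        subst this
        push_cast; ring)
  have hn := legQ_neg_one_sq m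
  have ho := legQ_one m
  simp only [derivative_mul, derivative_X, one_mul, eval_mul, eval_add, eval_X, eval_sub, eval_C]
    at h1 hr
  have i1 : ∀ f : ℝ → ℝ, Continuous f → IntervalIntegrable f volume (-1) 1 :=
    fun f hf => hf.intervalIntegrable _ _
  have c1 := (legQ m).continuous
  have c2 := (derivative (legQ m)).continuous
  have e1 : (∫ x in (-1:ℝ)..1, (legQ m).eval x * ((legQ m).eval x + x * (derivative (legQ m)).eval x))
      = (∫ x in (-1:ℝ)..1, (legQ m).eval x * (legQ m).eval x) +
        ∫ x in (-1:ℝ)..1, (derivative (legQ m)).eval x * (x * (legQ m).eval x) := by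
    rw [← intervalIntegral.integral_add (i1 _ (by fun_prop)) (i1 _ (by fun_prop))]
    congr 1; funext x; ring
  have e2 : (∫ x in (-1:ℝ)..1, (legQ m).eval x * (x * (derivative (legQ m)).eval x - m * (legQ m).eval x))
      = (∫ x in (-1:ℝ)..1, (derivative (legQ m)).eval x * (x * (legQ m).eval x)) -
        m * (∫ x in (-1:ℝ)..1, (legQ m).eval x * (legQ m).eval x) := by
    rw [← intervalIntegral.integral_const_mul,
      ← intervalIntegral.integral_sub (i1 _ (by fun_prop)) (i1 _ (by fun_prop))]
    congr 1; funext x; ring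
  rw [e1] at h1
  rw [e2] at hr
  rw [ho] at h1
  nlinarith [h1, hr, hn]

open Polynomial in
lemma legQ_coeff_ne (m : ℕ) : (legQ m).coeff m ≠ 0 := by
  intro h
  have := legQ_orth m (legQ m) (by
    rw [degree_lt_iff_coeff_zero]
    intro i hi
    rcases Nat.lt_or_ge m i with h' | h'
    · exact coeff_eq_zero_of_natDegree_lt (lt_of_le_of_lt (legQ_natDegree m) h')
    · have : m = i := by omega
      subst this; exact h)
  have h2 := legQ_norm m
  rw [this] at h2
  simp at h2

open Polynomial in
/-- Legendre expansion on the reference cell. -/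
lemma legQ_expand (n : ℕ) (q : ℝ[X]) (hq : q.degree < n) (s : ℝ) :
    q.eval s = ∑ m ∈ Finset.range n,
      (2 * (m:ℝ) + 1) / 2 * (∫ x in (-1:ℝ)..1, q.eval x * (legQ m).eval x) * (legQ m).eval s := by
  induction n generalizing q with
  | zero =>
    have : q = 0 := by
      rw [← degree_eq_bot]
      simpa using hq
    simp [this]
  | succ n ih =>
    set α := q.coeff n / (legQ n).coeff n with hα
    have hr : (q - C α * legQ n).degree < n := by
      rw [degree_lt_iff_coeff_zero] at hq ⊢
      intro i hi
      rw [coeff_sub, coeff_C_mul]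
      rcases Nat.lt_or_ge n i with h' | h'
      · rw [hq i (by omega),
          coeff_eq_zero_of_natDegree_lt (lt_of_le_of_lt (legQ_natDegree n) h')]; simp
      · have : n = i := by omega
        subst this
        rw [hα, div_mul_cancel₀ _ (legQ_coeff_ne n), sub_self]
    have i1 : ∀ f : ℝ → ℝ, Continuous f → IntervalIntegrable f volume (-1) 1 :=
      fun f hf => hf.intervalIntegrable _ _
    have cq := q.continuous
    have cl := fun m => (legQ m).continuous
    have key : ∀ m, (∫ x in (-1:ℝ)..1, (q - C α * legQ n).eval x * (legQ m).eval x) =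
        (∫ x in (-1:ℝ)..1, q.eval x * (legQ m).eval x) -
          α * ∫ x in (-1:ℝ)..1, (legQ n).eval x * (legQ m).eval x := by
      intro m
      have cn := cl n
      have cm := cl m
      rw [← intervalIntegral.integral_const_mul,
        ← intervalIntegral.integral_sub (i1 _ (by fun_prop)) (i1 _ (by fun_prop))]
      congr 1; funext x; simp; ring
    have h0 := ih _ hr
    have hn := legQ_orth n _ hr
    have hn2 : (∫ x in (-1:ℝ)..1, (q - C α * legQ n).eval x * (legQ n).eval x) = 0 := by
      rw [← hn]; congr 1; funext x; ring
    rw [key n] at hn2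
    have hnorm := legQ_norm n
    have hlast : (2 * (n:ℝ) + 1) / 2 * (∫ x in (-1:ℝ)..1, q.eval x * (legQ n).eval x) = α := by
      rw [sub_eq_zero.mp hn2]
      linear_combination α * hnorm
    rw [Finset.sum_range_succ, hlast]
    have : ∑ m ∈ Finset.range n, (2 * (m:ℝ) + 1) / 2 *
        (∫ x in (-1:ℝ)..1, q.eval x * (legQ m).eval x) * (legQ m).eval s =
        (q - C α * legQ n).eval s := by
      rw [h0]
      refine Finset.sum_congr rfl fun m hm => ?_
      have hm' := Finset.mem_range.mp hm
      rw [key m, legQ_orth n (legQ m), mul_zero, sub_zero]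
      exact lt_of_le_of_lt degree_le_natDegree
        (by exact_mod_cast lt_of_le_of_lt (legQ_natDegree m) hm')
    rw [this]
    simp

open Polynomial in
/-- Legendre polynomial on the cell, as a polynomial. -/
noncomputable def legC (m : ℕ) (a b : ℝ) : Polynomial ℝ :=
  (legQ m).comp (C (2 / (b - a)) * X + C (-((a + b) / (b - a))))

open Polynomial in
lemma legC_eval' (m : ℕ) (a b x : ℝ) :
    (legC m a b).eval x = (legQ m).eval (2 / (b - a) * x + -((a + b) / (b - a))) := by
  simp [legC, eval_comp]

lemma legC_eval (m : ℕ) (a b x : ℝ) : (legC m a b).eval x = legendreCell m a b x := by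
  rw [legC_eval', legQ_eval, legendreCell]
  congr 1
  ring

open Polynomial in
lemma natDegree_comp_lin (p : ℝ[X]) (c d : ℝ) : (p.comp (C c * X + C d)).natDegree ≤ p.natDegree := by
  refine natDegree_comp_le.trans ?_
  have : (C c * X + C d : ℝ[X]).natDegree ≤ 1 := by compute_degree
  calc _ ≤ p.natDegree * 1 := Nat.mul_le_mul_left _ this
    _ = _ := mul_one _

lemma legC_natDegree (m : ℕ) (a b : ℝ) : (legC m a b).natDegree ≤ m :=
  (natDegree_comp_lin _ _ _).trans (legQ_natDegree m)

lemma legC_b (m : ℕ) {a b : ℝ} (hab : a < b) : (legC m a b).eval b = 1 := by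
  rw [legC_eval']
  have : b - a ≠ 0 := by linarith
  rw [show 2 / (b - a) * b + -((a + b) / (b - a)) = 1 by field_simp; ring]
  exact legQ_one m

/-- change of variables to the reference cell -/
lemma cell_integral (f : ℝ → ℝ) {a b : ℝ} (hab : a < b) :
    (∫ x in a..b, f (2 / (b - a) * x + -((a + b) / (b - a)))) =
      (b - a) / 2 * ∫ s in (-1:ℝ)..1, f s := by
  have h0 : b - a ≠ 0 := by linarith
  rw [intervalIntegral.integral_comp_mul_add f (by positivity : 2 / (b - a) ≠ 0)]
  rw [show 2 / (b - a) * b + -((a + b) / (b - a)) = 1 by field_simp; ring,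
    show 2 / (b - a) * a + -((a + b) / (b - a)) = -1 by field_simp; ring]
  rw [smul_eq_mul, inv_div]

open Polynomial in
lemma legC_expand (n : ℕ) {a b : ℝ} (hab : a < b) (q : ℝ[X]) (hq : q.degree < n) (y : ℝ) :
    q.eval y = ∑ m ∈ Finset.range n,
      (2 * (m:ℝ) + 1) / (b - a) * (∫ x in a..b, q.eval x * (legC m a b).eval x) *
        (legC m a b).eval y := by
  have h0 : b - a ≠ 0 := by linarith
  set r : ℝ[X] := q.comp (C ((b - a) / 2) * X + C ((a + b) / 2)) with hr
  have hre : ∀ x, r.eval (2 / (b - a) * x + -((a + b) / (b - a))) = q.eval x := by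
    intro x
    rw [hr, eval_comp]
    congr 1
    simp only [eval_add, eval_mul, eval_C, eval_X]
    field_simp; ring
  have hrd : r.degree < n := by
    rcases eq_or_ne q 0 with h | h
    · rw [hr, h]; simp
    · have h1 : q.natDegree < n := (natDegree_lt_iff_degree_lt h).mpr hq
      exact lt_of_le_of_lt degree_le_natDegree
        (by exact_mod_cast lt_of_le_of_lt (natDegree_comp_lin _ _ _) h1)
  rw [← hre y, legQ_expand n r hrd]
  refine Finset.sum_congr rfl fun m _ => ?_
  rw [legC_eval']
  have := cell_integral (fun s => r.eval s * (legQ m).eval s) hab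
  simp only [hre] at this
  simp only [legC_eval']
  rw [this]
  field_simp

open Polynomial in
lemma legC_orth (m : ℕ) {a b : ℝ} (hab : a < b) (v : ℝ[X]) (hv : v.degree < m) :
    (∫ x in a..b, (legC m a b).eval x * v.eval x) = 0 := by
  have h0 : b - a ≠ 0 := by linarith
  set r : ℝ[X] := v.comp (C ((b - a) / 2) * X + C ((a + b) / 2)) with hr
  have hre : ∀ x, r.eval (2 / (b - a) * x + -((a + b) / (b - a))) = v.eval x := by
    intro x
    rw [hr, eval_comp]
    congr 1
    simp only [eval_add, eval_mul, eval_C, eval_X]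
    field_simp; ring
  have hrd : r.degree < m := by
    rcases eq_or_ne v 0 with h | h
    · rw [hr, h]; simp
    · have h1 : v.natDegree < m := (natDegree_lt_iff_degree_lt h).mpr hv
      exact lt_of_le_of_lt degree_le_natDegree
        (by exact_mod_cast lt_of_le_of_lt (natDegree_comp_lin _ _ _) h1)
  have := cell_integral (fun s => (legQ m).eval s * r.eval s) hab
  simp only [hre] at this
  simp only [legC_eval']
  rw [this, legQ_orth m r hrd, mul_zero]

/-- uniform bound for Legendre polynomials -/
lemma legC_bound (n : ℕ) : ∃ B : ℝ, 1 ≤ B ∧ ∀ m ≤ n, ∀ a b : ℝ, a < b → ∀ y ∈ Set.Icc a b,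
    |(legC m a b).eval y| ≤ B := by
  have hm : ∀ m, ∃ B : ℝ, ∀ s ∈ Set.Icc (-1:ℝ) 1, |(legQ m).eval s| ≤ B := by
    intro m
    obtain ⟨B, hB⟩ := isCompact_Icc.exists_bound_of_continuousOn
      (f := fun s => (legQ m).eval s) (s := Set.Icc (-1:ℝ) 1) (legQ m).continuous.continuousOn
    exact ⟨B, fun s hs => hB s hs⟩
  choose B hB using hm
  refine ⟨1 + ∑ i ∈ Finset.range (n+1), |B i|, ?_, ?_⟩
  · have : 0 ≤ ∑ i ∈ Finset.range (n+1), |B i| := Finset.sum_nonneg fun _ _ => abs_nonneg _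
    linarith
  · intro m hmn a b hab y hy
    have h0 : 0 < b - a := by linarith
    rw [legC_eval']
    have h1 := hB m (2 / (b - a) * y + -((a + b) / (b - a))) (by
      rw [show 2 / (b - a) * y + -((a + b) / (b - a)) = (2 * y - (a + b)) / (b - a) by ring]
      constructor
      · rw [le_div_iff₀ h0]; linarith [hy.1]
      · rw [div_le_iff₀ h0]; linarith [hy.2])
    have h2 := Finset.single_le_sum (f := fun i => |B i|) (fun i _ => abs_nonneg _)
      (Finset.mem_range.mpr (by omega : m < n + 1))
    have h3 := le_abs_self (B m)
    linarith

/-- Legendre coefficient on a cell -/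
noncomputable def lcoef (a b : ℝ) (g : ℝ → ℝ) (m : ℕ) : ℝ :=
  (2 * (m:ℝ) + 1) / (b - a) * ∫ x in a..b, g x * (legC m a b).eval x

open Polynomial in
/-- explicit Gauss–Radau projection -/
noncomputable def grP (k : ℕ) (a b : ℝ) (g : ℝ → ℝ) : Polynomial ℝ :=
  ∑ m ∈ Finset.range k, C (lcoef a b g m) * legC m a b +
    C (g b - ∑ m ∈ Finset.range k, lcoef a b g m) * legC k a b

open Polynomial in
lemma grP_eval (k : ℕ) (a b : ℝ) (g : ℝ → ℝ) (y : ℝ) :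
    (grP k a b g).eval y = ∑ m ∈ Finset.range k, lcoef a b g m * (legC m a b).eval y +
    (g b - ∑ m ∈ Finset.range k, lcoef a b g m) * (legC k a b).eval y := by
  simp [grP, eval_finsetSum]

open Polynomial in
lemma degree_lt_succ (v : ℝ[X]) (n : ℕ) (h : v.natDegree ≤ n) : v.degree < ((n+1 : ℕ) : WithBot ℕ) :=
  lt_of_le_of_lt degree_le_natDegree (by exact_mod_cast Nat.lt_succ_of_le h)

open Polynomial in
lemma gr_unique {k : ℕ} {a b : ℝ} (hab : a < b) {g : ℝ → ℝ} {P : ℝ[X]}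
    (h : IsGRProj k a b g P) (y : ℝ) : P.eval y = (grP k a b g).eval y := by
  obtain ⟨hd, ho, hb⟩ := h
  have hc : ∀ m ∈ Finset.range k, lcoef a b (fun x => P.eval x) m = lcoef a b g m := by
    intro m hm
    have hm' := Finset.mem_range.mp hm
    unfold lcoef
    rw [ho (legC m a b) (by have := legC_natDegree m a b; omega)]
  have hex : ∀ y, P.eval y = ∑ m ∈ Finset.range k, lcoef a b g m * (legC m a b).eval y +
      lcoef a b (fun x => P.eval x) k * (legC k a b).eval y := by
    intro y
    have := legC_expand (k+1) hab P (degree_lt_succ P k hd) y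
    rw [this, Finset.sum_range_succ]
    congr 1
    refine Finset.sum_congr rfl fun m hm => ?_
    rw [← hc m hm]; rfl
  have h1 := hex b
  simp only [legC_b _ hab, mul_one, hb] at h1
  rw [hex y, grP_eval, h1]
  ring

open Polynomial in
lemma pair_expand (n : ℕ) {a b : ℝ} (hab : a < b) {g : ℝ → ℝ} (hg : Continuous g) (v : ℝ[X])
    (hv : v.degree < n) : (∫ x in a..b, g x * v.eval x) = ∑ m ∈ Finset.range n,
      lcoef a b (fun x => v.eval x) m * ∫ x in a..b, g x * (legC m a b).eval x := by
  have : ∀ x, g x * v.eval x = ∑ m ∈ Finset.range n,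
      lcoef a b (fun x => v.eval x) m * (g x * (legC m a b).eval x) := by
    intro x
    rw [legC_expand n hab v hv x, Finset.mul_sum]
    refine Finset.sum_congr rfl fun m _ => ?_
    unfold lcoef; ring
  simp only [this]
  rw [intervalIntegral.integral_finsetSum]
  · simp only [intervalIntegral.integral_const_mul]
  · intro m _
    have := (legC m a b).continuous
    exact Continuous.intervalIntegrable (by fun_prop) _ _

open Polynomial in
lemma gr_exist {k : ℕ} {a b : ℝ} (hab : a < b) {g : ℝ → ℝ} (hg : Continuous g) :
    IsGRProj k a b g (grP k a b g) := by
  refine ⟨?_, ?_, ?_⟩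
  · unfold grP
    refine natDegree_add_le_of_degree_le (natDegree_sum_le_of_forall_le _ _ fun m hm => ?_) ?_
    · exact (natDegree_C_mul_le _ _).trans
        ((legC_natDegree m a b).trans (Finset.mem_range.mp hm).le)
    · exact (natDegree_C_mul_le _ _).trans (legC_natDegree k a b)
  · intro v hv
    have hvd : v.degree < k := lt_of_le_of_lt degree_le_natDegree (by exact_mod_cast hv)
    have c1 : ∀ m, Continuous fun x => (legC m a b).eval x := fun m => (legC m a b).continuous
    have cv := v.continuous
    rw [pair_expand k hab hg v hvd]
    simp only [grP_eval, add_mul, Finset.sum_mul]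
    rw [intervalIntegral.integral_add, intervalIntegral.integral_finsetSum]
    · simp only [mul_assoc, intervalIntegral.integral_const_mul]
      rw [legC_orth k hab v hvd, mul_zero, add_zero]
      refine Finset.sum_congr rfl fun m _ => ?_
      unfold lcoef
      simp only [mul_comm (eval _ (legC m a b))]
      ring
    · intro m _
      have := c1 m
      exact Continuous.intervalIntegrable (by fun_prop) _ _
    · exact Continuous.intervalIntegrable (continuous_finsetSum _ fun m _ => by
        have := c1 m
        fun_prop) _ _
    · have := c1 k
      exact Continuous.intervalIntegrable (by fun_prop) _ _
  · rw [grP_eval]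
    simp [legC_b _ hab]

lemma radau_eq {a b : ℝ} {g : ℝ → ℝ} (hg : Continuous g) (n : ℕ) :
    radauCoeff a b g n = g b - ∑ m ∈ Finset.range n, lcoef a b g m := by
  unfold radauCoeff
  congr 1
  simp only [← legC_eval, Finset.mul_sum]
  rw [intervalIntegral.integral_finsetSum, Finset.mul_sum]
  · refine Finset.sum_congr rfl fun m _ => ?_
    unfold lcoef
    rw [← intervalIntegral.integral_const_mul, ← intervalIntegral.integral_const_mul]
    congr 1; funext x; ring
  · intro m _
    have := (legC m a b).continuous
    exact Continuous.intervalIntegrable (by fun_prop) _ _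

lemma lcoef_sub {a b : ℝ} {f g : ℝ → ℝ} (hf : Continuous f) (hg : Continuous g) (m : ℕ) :
    lcoef a b (fun x => f x - g x) m = lcoef a b f m - lcoef a b g m := by
  unfold lcoef
  have := (legC m a b).continuous
  rw [← mul_sub, ← intervalIntegral.integral_sub
    (Continuous.intervalIntegrable (by fun_prop) _ _)
    (Continuous.intervalIntegrable (by fun_prop) _ _)]
  congr 2; funext x; ring

open Polynomial in
lemma lcoef_poly_sum {a b : ℝ} (hab : a < b) (n : ℕ) (q : ℝ[X]) (hq : q.natDegree ≤ n) :
    ∑ m ∈ Finset.range (n+1), lcoef a b (fun x => q.eval x) m = q.eval b := by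
  rw [legC_expand (n+1) hab q (degree_lt_succ q n hq) b]
  refine Finset.sum_congr rfl fun m _ => ?_
  rw [legC_b _ hab, mul_one]; rfl

open Polynomial in
lemma gr_err_pair {k : ℕ} {a b : ℝ} (hab : a < b) {g : ℝ → ℝ} (hg : Continuous g)
    {P : ℝ[X]} (h : IsGRProj k a b g P) (v : ℝ[X]) (hv : v.natDegree ≤ k) :
    (∫ x in a..b, (g x - P.eval x) * v.eval x) =
      - radauCoeff a b g (k+1) * ∫ x in a..b, (legC k a b).eval x * v.eval x := by
  have h0 : b - a ≠ 0 := by linarith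
  have hP := P.continuous
  have hz : ∀ m ∈ Finset.range k, (∫ x in a..b, (g x - P.eval x) * (legC m a b).eval x) = 0 := by
    intro m hm
    have hm' := Finset.mem_range.mp hm
    have := (legC m a b).continuous
    have h1 := h.2.1 (legC m a b) (by have := legC_natDegree m a b; omega)
    simp only [sub_mul]
    rw [intervalIntegral.integral_sub (Continuous.intervalIntegrable (by fun_prop) _ _)
      (Continuous.intervalIntegrable (by fun_prop) _ _), h1, sub_self]
  have hr : radauCoeff a b g (k+1) = - lcoef a b (fun x => g x - P.eval x) k := by
    rw [radau_eq hg, ← h.2.2, ← lcoef_poly_sum hab k P h.1, ← Finset.sum_sub_distrib,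
      Finset.sum_range_succ, Finset.sum_eq_zero, zero_add, lcoef_sub hg hP, neg_sub]
    intro m hm
    have : lcoef a b (fun x => g x - P.eval x) m = 0 := by
      unfold lcoef
      rw [hz m hm, mul_zero]
    rw [lcoef_sub hg hP] at this
    linarith
  rw [pair_expand (k+1) hab (g := fun x => g x - P.eval x) (by fun_prop) v (degree_lt_succ v k hv),
    Finset.sum_range_succ, Finset.sum_eq_zero, zero_add, hr]
  · unfold lcoef
    simp only [mul_comm (eval _ (legC k a b))]
    ring
  · intro m hm
    rw [hz m hm, mul_zero]

/-- abbreviation for the sum of `2m+1` -/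
noncomputable def sumOdd (n : ℕ) : ℝ := ∑ m ∈ Finset.range n, (2 * (m:ℝ) + 1)

lemma sumOdd_nonneg (n : ℕ) : 0 ≤ sumOdd n := Finset.sum_nonneg fun _ _ => by positivity

lemma int_abs_le {a b S : ℝ} (hab : a < b) {f : ℝ → ℝ} (hS : ∀ x ∈ Set.Icc a b, |f x| ≤ S) :
    |∫ x in a..b, f x| ≤ S * (b - a) := by
  have := intervalIntegral.norm_integral_le_of_norm_le_const (a := a) (b := b) (C := S) (f := f)
    (fun x hx => by
      rw [Set.uIoc_of_le hab.le] at hx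
      exact hS x ⟨hx.1.le, hx.2⟩)
  rwa [abs_of_pos (by linarith : 0 < b - a)] at this

lemma lcoef_bound {a b S B : ℝ} (hab : a < b) {g : ℝ → ℝ} (hS : ∀ x ∈ Set.Icc a b, |g x| ≤ S)
    (m : ℕ) (hB : ∀ x ∈ Set.Icc a b, |(legC m a b).eval x| ≤ B) :
    |lcoef a b g m| ≤ (2 * (m:ℝ) + 1) * (S * B) := by
  have h0 : 0 < b - a := by linarith
  have hS0 : 0 ≤ S := (abs_nonneg _).trans (hS a ⟨le_rfl, hab.le⟩)
  have h1 := int_abs_le hab (f := fun x => g x * (legC m a b).eval x) (S := S * B) (fun x hx => by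
    rw [abs_mul]
    exact mul_le_mul (hS x hx) (hB x hx) (abs_nonneg _) hS0)
  unfold lcoef
  rw [abs_mul, abs_of_nonneg (by positivity : 0 ≤ (2 * (m:ℝ) + 1) / (b - a))]
  calc _ ≤ (2 * (m:ℝ) + 1) / (b - a) * (S * B * (b - a)) := by gcongr
    _ = _ := by field_simp

lemma lcoef_sum_bound {a b S B : ℝ} (hab : a < b) {g : ℝ → ℝ} (n : ℕ)
    (hS : ∀ x ∈ Set.Icc a b, |g x| ≤ S)
    (hB : ∀ m < n, ∀ x ∈ Set.Icc a b, |(legC m a b).eval x| ≤ B) :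
    ∑ m ∈ Finset.range n, |lcoef a b g m| ≤ sumOdd n * (S * B) := by
  unfold sumOdd
  rw [Finset.sum_mul]
  exact Finset.sum_le_sum fun m hm => lcoef_bound hab hS m (hB m (Finset.mem_range.mp hm))

lemma grP_bound {k : ℕ} {a b S B : ℝ} (hab : a < b) {g : ℝ → ℝ} (hB1 : 1 ≤ B)
    (hS : ∀ x ∈ Set.Icc a b, |g x| ≤ S)
    (hB : ∀ m ≤ k, ∀ x ∈ Set.Icc a b, |(legC m a b).eval x| ≤ B) (y : ℝ) (hy : y ∈ Set.Icc a b) :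
    |(grP k a b g).eval y| ≤ (2 * sumOdd k * B * B + B) * S := by
  have h1 := lcoef_sum_bound hab k hS (fun m hm => hB m hm.le)
  have hS0 : 0 ≤ S := (abs_nonneg _).trans (hS a ⟨le_rfl, hab.le⟩)
  have hgb := hS b ⟨hab.le, le_rfl⟩
  rw [grP_eval]
  have h2 : |∑ m ∈ Finset.range k, lcoef a b g m * (legC m a b).eval y| ≤ sumOdd k * (S * B) * B := by
    refine (Finset.abs_sum_le_sum_abs _ _).trans ?_
    calc _ ≤ ∑ m ∈ Finset.range k, |lcoef a b g m| * B := by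
          refine Finset.sum_le_sum fun m hm => ?_
          rw [abs_mul]
          gcongr
          exact hB m (Finset.mem_range.mp hm).le y hy
      _ = (∑ m ∈ Finset.range k, |lcoef a b g m|) * B := by rw [Finset.sum_mul]
      _ ≤ _ := by gcongr
  have h3 : |g b - ∑ m ∈ Finset.range k, lcoef a b g m| ≤ S + sumOdd k * (S * B) := by
    refine (abs_sub _ _).trans ?_
    exact add_le_add hgb ((Finset.abs_sum_le_sum_abs _ _).trans h1)
  have h4 : |(g b - ∑ m ∈ Finset.range k, lcoef a b g m) * (legC k a b).eval y| ≤
      (S + sumOdd k * (S * B)) * B := by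
    rw [abs_mul]
    exact mul_le_mul h3 (hB k le_rfl y hy) (abs_nonneg _) ((abs_nonneg _).trans h3)
  refine (abs_add_le _ _).trans ?_
  linarith

open Polynomial in
lemma radau_bound {k : ℕ} {a b S B : ℝ} (hab : a < b) {g : ℝ → ℝ} (hg : Continuous g) (p : ℝ[X])
    (hp : p.natDegree ≤ k)
    (hS : ∀ x ∈ Set.Icc a b, |g x - p.eval x| ≤ S)
    (hB : ∀ m ≤ k, ∀ x ∈ Set.Icc a b, |(legC m a b).eval x| ≤ B) :
    |radauCoeff a b g (k+1)| ≤ (1 + sumOdd (k+1) * B) * S := by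
  have hP := p.continuous
  have h1 := lcoef_sum_bound hab (k+1) hS (fun m hm => hB m (by omega))
  have h2 := hS b ⟨hab.le, le_rfl⟩
  have : radauCoeff a b g (k+1) = (g b - p.eval b) -
      ∑ m ∈ Finset.range (k+1), lcoef a b (fun x => g x - p.eval x) m := by
    simp only [lcoef_sub hg hP]
    rw [radau_eq hg, Finset.sum_sub_distrib, lcoef_poly_sum hab k p hp]
    ring
  rw [this]
  refine (abs_sub _ _).trans ?_
  have h3 := (Finset.abs_sum_le_sum_abs (fun m => lcoef a b (fun x => g x - p.eval x) m)
    (Finset.range (k+1))).trans h1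
  linarith

lemma pder {a b : ℝ} {g g' : ℝ → ℝ} (hg : ∀ x, HasDerivAt g (g' x) x) (hg' : Continuous g')
    {K : ℝ → ℝ} (hK : Continuous K) (t : ℝ) :
    HasDerivAt (fun s => ∫ y in a..b, g (y - s) * K y) (-∫ y in a..b, g' (y - t) * K y) t := by
  have hgc : Continuous g := continuous_iff_continuousAt.mpr fun x => (hg x).continuousAt
  have hc : Continuous fun p : ℝ × ℝ => -(g' (p.2 - p.1) * K p.2) := by fun_prop
  obtain ⟨C, hC⟩ := ((isCompact_closedBall t 1).prod (isCompact_uIcc (a := a) (b := b))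
    ).exists_bound_of_continuousOn hc.continuousOn
  have := intervalIntegral.hasDerivAt_integral_of_dominated_loc_of_deriv_le (μ := volume)
    (a := a) (b := b) (x₀ := t) (s := Metric.ball t 1)
    (F := fun s y => g (y - s) * K y) (F' := fun s y => -(g' (y - s) * K y)) (bound := fun _ => C)
    (Metric.ball_mem_nhds t one_pos)
    (Filter.Eventually.of_forall fun s => by
      refine Continuous.aestronglyMeasurable ?_
      fun_prop)
    (Continuous.intervalIntegrable (by fun_prop) _ _)
    (by
      refine Continuous.aestronglyMeasurable ?_
      fun_prop)
    (Filter.Eventually.of_forall fun y hy s hs => by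
      exact hC (s, y) ⟨Metric.ball_subset_closedBall hs, Set.uIoc_subset_uIcc hy⟩)
    (by simp)
    (Filter.Eventually.of_forall fun y hy s hs => by
      have h1 : HasDerivAt (fun s => y - s) (-1) s := by
        simpa using (hasDerivAt_id s).const_sub y
      have h2 := ((hg (y - s)).comp s h1).mul_const (K y)
      simp only [Function.comp_def] at h2
      refine HasDerivAt.congr_deriv h2 ?_
      ring)
  have h3 := this.2
  rwa [intervalIntegral.integral_neg] at h3

lemma shift_der {g g' : ℝ → ℝ} (hg : ∀ x, HasDerivAt g (g' x) x) (y s : ℝ) :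
    HasDerivAt (fun s => g (y - s)) (-g' (y - s)) s := by
  have h1 : HasDerivAt (fun s => y - s) (-1) s := by
    simpa using (hasDerivAt_id s).const_sub y
  have h2 := (hg (y - s)).comp s h1
  simp only [Function.comp_def] at h2
  refine HasDerivAt.congr_deriv h2 ?_
  ring

lemma radau_der {a b : ℝ} {g g' : ℝ → ℝ} (hg : ∀ x, HasDerivAt g (g' x) x) (hg' : Continuous g')
    (n : ℕ) (t : ℝ) :
    HasDerivAt (fun s => radauCoeff a b (fun y => g (y - s)) n)
      (-radauCoeff a b (fun y => g' (y - t)) n) t := by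
  have hK : Continuous fun x => ∑ l ∈ Finset.range n, (2 * (l:ℝ) + 1) * legendreCell l a b x := by
    simp only [← legC_eval]
    refine continuous_finsetSum _ fun m _ => ?_
    have := (legC m a b).continuous
    fun_prop
  have h1 := (shift_der hg b t).sub ((pder (a := a) (b := b) hg hg' hK t).const_mul (1 / (b - a)))
  unfold radauCoeff
  refine HasDerivAt.congr_deriv h1 ?_
  ring

lemma lcoef_der {a b : ℝ} {g g' : ℝ → ℝ} (hg : ∀ x, HasDerivAt g (g' x) x) (hg' : Continuous g')
    (m : ℕ) (t : ℝ) :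
    HasDerivAt (fun s => lcoef a b (fun y => g (y - s)) m)
      (-lcoef a b (fun y => g' (y - t)) m) t := by
  have h1 := (pder (a := a) (b := b) hg hg' (legC m a b).continuous t).const_mul
    ((2 * (m:ℝ) + 1) / (b - a))
  unfold lcoef
  refine HasDerivAt.congr_deriv h1 ?_
  ring

lemma grP_der {k : ℕ} {a b : ℝ} {g g' : ℝ → ℝ} (hg : ∀ x, HasDerivAt g (g' x) x)
    (hg' : Continuous g') (y t : ℝ) :
    HasDerivAt (fun s => (grP k a b (fun y => g (y - s))).eval y)
      (-(grP k a b (fun y => g' (y - t))).eval y) t := by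
  simp only [grP_eval]
  have h1 := HasDerivAt.fun_sum (u := Finset.range k) (x := t)
    (A := fun m s => lcoef a b (fun y => g (y - s)) m * (legC m a b).eval y)
    (fun m _ => (lcoef_der hg hg' m t).mul_const ((legC m a b).eval y))
  have h2 := HasDerivAt.fun_sum (u := Finset.range k) (x := t)
    (A := fun m s => lcoef a b (fun y => g (y - s)) m)
    (fun m _ => (lcoef_der hg hg' m t))
  have h3 := h1.add (((shift_der hg b t).sub h2).mul_const ((legC k a b).eval y))
  refine HasDerivAt.congr_deriv h3 ?_
  simp only [neg_mul, Finset.sum_neg_distrib]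
  ring

lemma iter_hasDeriv {u0 : ℝ → ℝ} {n : ℕ} (hu : ContDiff ℝ n u0) (i : ℕ) (hi : i < n) (x : ℝ) :
    HasDerivAt (iteratedDeriv i u0) (iteratedDeriv (i+1) u0 x) x := by
  rw [iteratedDeriv_succ]
  exact (hu.differentiable_iteratedDeriv i (by exact_mod_cast hi) x).hasDerivAt

lemma Gfun_eq {k : ℕ} {a b : ℝ} {u0 : ℝ → ℝ} {n : ℕ} (hu : ContDiff ℝ n u0) (i : ℕ) (hi : i ≤ n)
    (t : ℝ) : Gfun k a b u0 i t =
      (-1) ^ i * radauCoeff a b (fun y => iteratedDeriv i u0 (y - t)) (k+1) := by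
  induction i generalizing t with
  | zero => simp [Gfun]
  | succ i ih =>
    have h1 : iteratedDeriv i (fun s => radauCoeff a b (fun y => u0 (y - s)) (k + 1)) =
        fun t => (-1) ^ i * radauCoeff a b (fun y => iteratedDeriv i u0 (y - t)) (k+1) := by
      funext s
      exact ih (by omega) s
    unfold Gfun
    rw [iteratedDeriv_succ, h1]
    have h2 := (radau_der (a := a) (b := b) (fun x => iter_hasDeriv hu i hi x)
      (hu.continuous_iteratedDeriv (i+1) (by exact_mod_cast hi)) (k+1) t).const_mul ((-1:ℝ)^i)
    rw [h2.deriv]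
    ring

lemma Gfun_der {k : ℕ} {a b : ℝ} {u0 : ℝ → ℝ} {n : ℕ} (hu : ContDiff ℝ n u0) (i : ℕ) (hi : i < n)
    (t : ℝ) : HasDerivAt (fun s => Gfun k a b u0 i s) (Gfun k a b u0 (i+1) t) t := by
  have h2 := (radau_der (a := a) (b := b) (fun x => iter_hasDeriv hu i hi x)
      (hu.continuous_iteratedDeriv (i+1) (by exact_mod_cast hi)) (k+1) t).const_mul ((-1:ℝ)^i)
  simp only [Gfun_eq hu i hi.le]
  rw [Gfun_eq hu (i+1) hi]
  refine HasDerivAt.congr_deriv h2 ?_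
  ring

open Polynomial in
lemma taylor_poly {k : ℕ} {a b M : ℝ} (hab : a < b) {w : ℝ → ℝ} (hw : ContDiff ℝ (k+1) w)
    (hM : ∀ y ∈ Set.Icc a b, |iteratedDeriv (k+1) w y| ≤ M) :
    ∃ p : ℝ[X], p.natDegree ≤ k ∧ ∀ x ∈ Set.Icc a b, |w x - p.eval x| ≤ M * (b - a) ^ (k+1) := by
  refine ⟨∑ i ∈ Finset.range (k+1),
    C ((Nat.factorial i : ℝ)⁻¹ * iteratedDerivWithin i w (Set.Icc a b) a) * (X - C a) ^ i, ?_, ?_⟩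
  · refine natDegree_sum_le_of_forall_le _ _ fun i hi => ?_
    refine (natDegree_C_mul_le _ _).trans ?_
    rw [natDegree_pow, natDegree_X_sub_C]
    have := Finset.mem_range.mp hi
    omega
  · intro x hx
    have hM0 : 0 ≤ M := (abs_nonneg _).trans (hM a ⟨le_rfl, hab.le⟩)
    have h1 := taylor_mean_remainder_bound (n := k) (C := M) hab.le hw.contDiffOn hx (by
      intro y hy
      rw [iteratedDerivWithin_eq_iteratedDeriv (uniqueDiffOn_Icc hab) (by
        exact_mod_cast hw.contDiffAt) hy]
      exact hM y hy)
    rw [taylor_within_apply, Real.norm_eq_abs] at h1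
    have e : (∑ i ∈ Finset.range (k+1),
        C ((Nat.factorial i : ℝ)⁻¹ * iteratedDerivWithin i w (Set.Icc a b) a) * (X - C a) ^ i
        : ℝ[X]).eval x = ∑ i ∈ Finset.range (k + 1), ((Nat.factorial i : ℝ)⁻¹ * (x - a) ^ i) •
          iteratedDerivWithin i w (Set.Icc a b) a := by
      simp only [eval_finsetSum, eval_mul, eval_C, eval_pow, eval_sub, eval_X, smul_eq_mul]
      refine Finset.sum_congr rfl fun i _ => by ring
    rw [e]
    refine h1.trans ?_
    have hf : (1:ℝ) ≤ Nat.factorial k := by exact_mod_cast Nat.one_le_iff_ne_zero.mpr (Nat.factorial_ne_zero k)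
    have hx0 : 0 ≤ x - a := by linarith [hx.1]
    calc _ ≤ M * (x - a) ^ (k+1) := div_le_self (by positivity) hf
      _ ≤ _ := by
        gcongr
        exact hx.2

lemma Gfun_bound {k l : ℕ} {a b B M t : ℝ} (hab : a < b) {u0 : ℝ → ℝ}
    (hu : ContDiff ℝ ((k+l+2 : ℕ)) u0)
    (hM : ∀ y ∈ Set.Icc (a-t) (b-t), |iteratedDeriv (k+l+2) u0 y| ≤ M)
    (hB : ∀ m ≤ k, ∀ x ∈ Set.Icc a b, |(legC m a b).eval x| ≤ B) :
    |Gfun k a b u0 (l+1) t| ≤ (1 + sumOdd (k+1) * B) * (M * (b - a) ^ (k+1)) := by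
  rw [Gfun_eq hu (l+1) (by omega), abs_mul, abs_pow, abs_neg, abs_one, one_pow, one_mul]
  have hw : ContDiff ℝ (k+1) (iteratedDeriv (l+1) u0) := by
    rw [iteratedDeriv_eq_iterate]
    have := ContDiff.iterate_deriv' (k+1) (l+1) (f := u0) (𝕜 := ℝ) (by
      rw [show k + 1 + (l + 1) = k + l + 2 by ring]
      exact hu)
    exact_mod_cast this
  have hit : iteratedDeriv (k+1) (fun y => iteratedDeriv (l+1) u0 (y - t)) =
      fun y => iteratedDeriv (k+l+2) u0 (y - t) := by
    rw [iteratedDeriv_comp_sub_const]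
    funext y
    simp only [iteratedDeriv_eq_iterate]
    rw [← Function.iterate_add_apply]
    rw [show k + 1 + (l + 1) = k + l + 2 by ring]
  have hw2 : ContDiff ℝ (k+1) (fun y => iteratedDeriv (l+1) u0 (y - t)) := by
    exact hw.comp (contDiff_id.sub contDiff_const)
  obtain ⟨p, hp, hpS⟩ := taylor_poly hab hw2 (M := M) (by
    intro y hy
    rw [hit]
    exact hM _ ⟨by linarith [hy.1], by linarith [hy.2]⟩)
  exact radau_bound hab hw2.continuous p hp hpS hB

open Polynomial in
lemma antider (v : ℝ[X]) : ∃ V : ℝ[X], derivative V = v ∧ V.natDegree ≤ v.natDegree + 1 := by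
  refine ⟨∑ i ∈ Finset.range (v.natDegree + 1), C (v.coeff i / ((i:ℝ)+1)) * X ^ (i+1), ?_, ?_⟩
  · conv_rhs => rw [v.as_sum_range_C_mul_X_pow]
    rw [derivative_sum]
    refine Finset.sum_congr rfl fun i _ => ?_
    rw [derivative_C_mul_X_pow]
    have : (i:ℝ) + 1 ≠ 0 := by positivity
    simp only [Nat.cast_add, Nat.cast_one, Nat.add_sub_cancel]
    rw [div_mul_cancel₀ _ this]
  · refine natDegree_sum_le_of_forall_le _ _ fun i hi => ?_
    refine (natDegree_C_mul_X_pow_le _ _).trans ?_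
    have := Finset.mem_range.mp hi
    omega

lemma dinv_hasDeriv {a b : ℝ} {f : ℝ → ℝ} (hf : Continuous f) (x : ℝ) :
    HasDerivAt (Dinv a b f) (2 / (b - a) * f x) x := by
  unfold Dinv
  exact (intervalIntegral.integral_hasDerivAt_right (hf.intervalIntegrable _ _)
    (hf.stronglyMeasurableAtFilter _ _) hf.continuousAt).const_mul _

open Polynomial in
lemma dinv_ibp {a b : ℝ} {f : ℝ → ℝ} (hf : Continuous f) (h0 : (∫ x in a..b, f x) = 0) (V : ℝ[X]) :
    (∫ x in a..b, Dinv a b f x * (derivative V).eval x) =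
      -(2 / (b - a)) * ∫ x in a..b, f x * V.eval x := by
  rw [intervalIntegral.integral_mul_deriv_eq_deriv_mul (u := Dinv a b f)
    (v := fun x => V.eval x) (u' := fun x => 2 / (b - a) * f x)
    (fun x _ => dinv_hasDeriv hf x) (fun x _ => V.hasDerivAt x)
    (Continuous.intervalIntegrable (by fun_prop) _ _) (poly_ii _ _ _)]
  have ha : Dinv a b f a = 0 := by simp [Dinv]
  have hb : Dinv a b f b = 0 := by simp [Dinv, h0]
  rw [ha, hb]
  simp only [mul_assoc, intervalIntegral.integral_const_mul]
  ring

/-- the sequence `F` extended by `F 0 = -L_k` -/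
noncomputable def Ft (k : ℕ) (a b : ℝ) (F : ℕ → Polynomial ℝ) (i : ℕ) : Polynomial ℝ :=
  if i = 0 then -legC k a b else F i

lemma IsGRProj.neg {k : ℕ} {a b : ℝ} {u : ℝ → ℝ} {P : Polynomial ℝ} (h : IsGRProj k a b u P) :
    IsGRProj k a b (fun x => -u x) (-P) := by
  obtain ⟨h1, h2, h3⟩ := h
  refine ⟨by simpa using h1, fun v hv => ?_, by simpa using h3⟩
  simp only [Polynomial.eval_neg, neg_mul, intervalIntegral.integral_neg]
  rw [h2 v hv]

lemma Ft_proj {k : ℕ} {a b : ℝ} {F : ℕ → Polynomial ℝ} (h : IsFSeq k a b F) (i : ℕ) :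
    IsGRProj k a b (Dinv a b (fun x => (Ft k a b F i).eval x)) (-(Ft k a b F (i+1))) := by
  rcases i with _ | i
  · have h1 := h.1.neg
    have e : (fun x => -Dinv a b (legendreCell k a b) x) =
        Dinv a b (fun x => (Ft k a b F 0).eval x) := by
      funext x
      simp only [Dinv, Ft, if_true, Polynomial.eval_neg, legC_eval, intervalIntegral.integral_neg]
      ring
    rw [e] at h1
    simpa [Ft] using h1
  · simpa [Ft] using h.2 (i+2) (by omega)

open Polynomial in
lemma Ft_orth {k : ℕ} {a b : ℝ} (hab : a < b) {F : ℕ → ℝ[X]} (h : IsFSeq k a b F) (i : ℕ)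
    (v : ℝ[X]) (hv : v.natDegree + i + 1 ≤ k) :
    (∫ x in a..b, (Ft k a b F i).eval x * v.eval x) = 0 := by
  induction i generalizing v with
  | zero =>
    simp only [Ft, if_true, eval_neg, neg_mul, intervalIntegral.integral_neg]
    rw [legC_orth k hab v, neg_zero]
    exact lt_of_le_of_lt degree_le_natDegree (by exact_mod_cast (by omega : v.natDegree < k))
  | succ i ih =>
    have h1 := (Ft_proj h i).2.1 v (by omega)
    obtain ⟨V, rfl, hV⟩ := antider v
    have h0 := ih 1 (by simp; omega)
    simp only [eval_one, mul_one] at h0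
    rw [dinv_ibp (Ft k a b F i).continuous h0, ih V (by omega)] at h1
    simp only [eval_neg, neg_mul, intervalIntegral.integral_neg, mul_zero] at h1
    linarith

open Polynomial in
lemma Ft_ibp {k : ℕ} {a b : ℝ} (hab : a < b) {F : ℕ → ℝ[X]} (h : IsFSeq k a b F) (i : ℕ)
    (hi : i + 1 ≤ k) (V : ℝ[X]) (hV : V.natDegree ≤ k) :
    (∫ x in a..b, (Ft k a b F (i+1)).eval x * (derivative V).eval x) =
      2 / (b - a) * ∫ x in a..b, (Ft k a b F i).eval x * V.eval x := by
  have h1 := (Ft_proj h i).2.1 (derivative V) (by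
    have := natDegree_derivative_le V
    omega)
  have h0 := Ft_orth hab h i 1 (by simp; omega)
  simp only [eval_one, mul_one] at h0
  rw [dinv_ibp (Ft k a b F i).continuous h0] at h1
  simp only [eval_neg, neg_mul, intervalIntegral.integral_neg] at h1
  linarith

open Polynomial in
lemma Ft_b {k : ℕ} {a b : ℝ} (hab : a < b) {F : ℕ → ℝ[X]} (h : IsFSeq k a b F) (i : ℕ)
    (hi : i + 1 ≤ k) : (Ft k a b F (i+1)).eval b = 0 := by
  have h1 := (Ft_proj h i).2.2
  have h0 := Ft_orth hab h i 1 (by simp; omega)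
  simp only [eval_one, mul_one] at h0
  simp only [Dinv, h0, mul_zero, eval_neg] at h1
  linarith

lemma Ft_bound {k : ℕ} {a b B : ℝ} (hab : a < b) {F : ℕ → Polynomial ℝ} (h : IsFSeq k a b F)
    (hB1 : 1 ≤ B) (hB : ∀ m ≤ k, ∀ x ∈ Set.Icc a b, |(legC m a b).eval x| ≤ B) (i : ℕ) :
    ∀ y ∈ Set.Icc a b,
      |(Ft k a b F i).eval y| ≤ B * (2 * (2 * sumOdd k * B * B + B)) ^ i := by
  induction i with
  | zero =>
    intro y hy
    simpa [Ft] using hB k le_rfl y hy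
  | succ i ih =>
    intro y hy
    set S := B * (2 * (2 * sumOdd k * B * B + B)) ^ i with hS
    have hS0 : 0 ≤ S := (abs_nonneg _).trans (ih y hy)
    have h0 : 0 < b - a := by linarith
    have h1 := gr_unique hab (Ft_proj h i) y
    have h2 := grP_bound (k := k) hab (S := 2 * S) hB1
      (g := Dinv a b (fun x => (Ft k a b F i).eval x)) (fun x hx => by
        unfold Dinv
        rw [abs_mul, abs_of_pos (by positivity : 0 < 2 / (b - a))]
        have h3 : |∫ t in a..x, (Ft k a b F i).eval t| ≤ S * (b - a) := by
          have := intervalIntegral.norm_integral_le_of_norm_le_const (a := a) (b := x) (C := S)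
            (f := fun t => (Ft k a b F i).eval t) (fun z hz => by
              rw [Set.uIoc_of_le hx.1] at hz
              exact ih z ⟨hz.1.le, hz.2.trans hx.2⟩)
          rw [abs_of_nonneg (by linarith [hx.1] : 0 ≤ x - a)] at this
          refine this.trans ?_
          gcongr
          exact hx.2
        calc _ ≤ 2 / (b - a) * (S * (b - a)) := by gcongr
          _ = _ := by field_simp) hB y hy
    rw [← h1, Polynomial.eval_neg, abs_neg] at h2
    refine h2.trans (le_of_eq ?_)
    rw [hS]; ring

lemma sum_Icc_one (f : ℕ → ℝ) (l : ℕ) :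
    ∑ i ∈ Finset.Icc 1 l, f i = ∑ i ∈ Finset.range l, f (i+1) := by
  induction l with
  | zero => simp
  | succ n ih => rw [Finset.sum_Icc_succ_top (by omega), Finset.sum_range_succ, ih]

lemma wSum_eq (k l : ℕ) (a b : ℝ) (u0 : ℝ → ℝ) (F : ℕ → Polynomial ℝ) (y t : ℝ) :
    wSum k a b u0 F l y t = ∑ i ∈ Finset.range l,
      ((b - a) / 2) ^ (i+1) * Gfun k a b u0 (i+1) t * (Ft k a b F (i+1)).eval y := by
  unfold wSum
  rw [sum_Icc_one]
  rfl

lemma err_b {k l : ℕ} {a b : ℝ} (hab : a < b) (hlk : l ≤ k) {u0 : ℝ → ℝ}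
    {P : ℝ → Polynomial ℝ} (hP : ∀ t, IsGRProj k a b (fun y => u0 (y - t)) (P t))
    {F : ℕ → Polynomial ℝ} (hF : IsFSeq k a b F) (t : ℝ) :
    u0 (b - t) - uIl k a b u0 P F l b t = 0 := by
  unfold uIl
  rw [(hP t).2.2, wSum_eq, Finset.sum_eq_zero]
  · ring
  · intro i hi
    rw [Ft_b hab hF i (by have := Finset.mem_range.mp hi; omega), mul_zero]

lemma err_der {k l : ℕ} {a b : ℝ} (hab : a < b) {u0 : ℝ → ℝ}
    (hu : ContDiff ℝ ((k+l+2 : ℕ)) u0)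
    {P : ℝ → Polynomial ℝ} (hP : ∀ t, IsGRProj k a b (fun y => u0 (y - t)) (P t))
    (F : ℕ → Polynomial ℝ) (y t : ℝ) :
    HasDerivAt (fun s => u0 (y - s) - uIl k a b u0 P F l y s)
      (-(iteratedDeriv 1 u0 (y - t) - (grP k a b (fun y => iteratedDeriv 1 u0 (y - t))).eval y) +
        ∑ i ∈ Finset.range l,
          ((b - a) / 2) ^ (i+1) * Gfun k a b u0 (i+2) t * (Ft k a b F (i+1)).eval y) t := by
  have hg : ∀ x, HasDerivAt u0 (iteratedDeriv 1 u0 x) x := fun x => by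
    simpa using iter_hasDeriv hu 0 (by omega) x
  have hg' : Continuous (iteratedDeriv 1 u0) :=
    hu.continuous_iteratedDeriv 1 (by exact_mod_cast (by omega : 1 ≤ k + l + 2))
  unfold uIl
  simp only [wSum_eq, gr_unique hab (hP _)]
  have h1 := HasDerivAt.fun_sum (u := Finset.range l) (x := t)
    (A := fun i s => ((b - a) / 2) ^ (i+1) * Gfun k a b u0 (i+1) s * (Ft k a b F (i+1)).eval y)
    (fun i hi => ((Gfun_der (k := k) (a := a) (b := b) hu (i+1)
      (by have := Finset.mem_range.mp hi; omega) t).const_mul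
        (((b - a) / 2) ^ (i+1))).mul_const ((Ft k a b F (i+1)).eval y))
  have h2 := (shift_der hg y t).sub ((grP_der (k := k) (a := a) (b := b) hg hg' y t).sub h1)
  refine HasDerivAt.congr_deriv h2 ?_
  ring

open Polynomial in
lemma err_main {k l : ℕ} {a b : ℝ} (hab : a < b) (hk : 1 ≤ k) (hlk : l ≤ k) {u0 : ℝ → ℝ}
    (hu : ContDiff ℝ ((k+l+2 : ℕ)) u0)
    {P : ℝ → ℝ[X]} (hP : ∀ t, IsGRProj k a b (fun y => u0 (y - t)) (P t))
    {F : ℕ → ℝ[X]} (hF : IsFSeq k a b F) (t : ℝ) (v : ℝ[X]) (hv : v.natDegree ≤ k) :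
    (∫ y in a..b, deriv (fun s => u0 (y - s) - uIl k a b u0 P F l y s) t * v.eval y)
      - (∫ y in a..b, (u0 (y - t) - uIl k a b u0 P F l y t) * (derivative v).eval y) =
    ((b - a) / 2) ^ l * Gfun k a b u0 (l+1) t * ∫ y in a..b, (Ft k a b F l).eval y * v.eval y := by
  have hba : b - a ≠ 0 := by linarith
  have hg' : Continuous (iteratedDeriv 1 u0) :=
    hu.continuous_iteratedDeriv 1 (by exact_mod_cast (by omega : 1 ≤ k + l + 2))
  have hgs : Continuous fun y => iteratedDeriv 1 u0 (y - t) := by fun_prop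
  have hu0 : Continuous fun y => u0 (y - t) := by
    have := hu.continuous
    fun_prop
  have cv := v.continuous
  have cdv := (derivative v).continuous
  have cF : ∀ i, Continuous fun y => (Ft k a b F i).eval y := fun i => (Ft k a b F i).continuous
  have cg := (grP k a b (fun y => iteratedDeriv 1 u0 (y - t))).continuous
  have cP := (P t).continuous
  -- first integral
  have I1 : (∫ y in a..b, deriv (fun s => u0 (y - s) - uIl k a b u0 P F l y s) t * v.eval y) =
      Gfun k a b u0 1 t * (∫ y in a..b, (Ft k a b F 0).eval y * v.eval y) +
      ∑ i ∈ Finset.range l, ((b - a) / 2) ^ (i+1) * Gfun k a b u0 (i+2) t *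
        ∫ y in a..b, (Ft k a b F (i+1)).eval y * v.eval y := by
    simp only [(err_der hab hu hP F _ t).deriv]
    simp only [add_mul, Finset.sum_mul]
    rw [intervalIntegral.integral_add, intervalIntegral.integral_finsetSum]
    · congr 1
      · simp only [neg_mul, intervalIntegral.integral_neg]
        rw [gr_err_pair hab hgs (gr_exist hab hgs) v hv, Gfun_eq hu 1 (by omega)]
        simp [Ft]
      · refine Finset.sum_congr rfl fun i _ => ?_
        rw [← intervalIntegral.integral_const_mul]
        congr 1; funext y; ring
    · intro i _
      have := cF (i+1)
      exact Continuous.intervalIntegrable (by fun_prop) _ _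
    · exact Continuous.intervalIntegrable (by fun_prop) _ _
    · refine Continuous.intervalIntegrable (continuous_finsetSum _ fun i _ => ?_) _ _
      have := cF (i+1)
      fun_prop
  have I2 : (∫ y in a..b, (u0 (y - t) - uIl k a b u0 P F l y t) * (derivative v).eval y) =
      ∑ i ∈ Finset.range l, ((b - a) / 2) ^ (i+1) * Gfun k a b u0 (i+1) t *
        ∫ y in a..b, (Ft k a b F (i+1)).eval y * (derivative v).eval y := by
    have e : ∀ y, (u0 (y - t) - uIl k a b u0 P F l y t) * (derivative v).eval y =
        (u0 (y - t) * (derivative v).eval y - (P t).eval y * (derivative v).eval y) +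
        ∑ i ∈ Finset.range l, ((b - a) / 2) ^ (i+1) * Gfun k a b u0 (i+1) t *
          ((Ft k a b F (i+1)).eval y * (derivative v).eval y) := by
      intro y
      unfold uIl
      rw [wSum_eq]
      have : ∑ i ∈ Finset.range l, ((b - a) / 2) ^ (i+1) * Gfun k a b u0 (i+1) t *
          ((Ft k a b F (i+1)).eval y * (derivative v).eval y) =
          (∑ i ∈ Finset.range l, ((b - a) / 2) ^ (i+1) * Gfun k a b u0 (i+1) t *
          (Ft k a b F (i+1)).eval y) * (derivative v).eval y := by
        rw [Finset.sum_mul]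
        exact Finset.sum_congr rfl fun i _ => by ring
      rw [this]; ring
    simp only [e]
    have ho := (hP t).2.1 (derivative v) (by
      have := natDegree_derivative_le v
      omega)
    rw [intervalIntegral.integral_add, intervalIntegral.integral_finsetSum,
      intervalIntegral.integral_sub, ho, sub_self, zero_add]
    · simp only [intervalIntegral.integral_const_mul]
    · exact Continuous.intervalIntegrable (by fun_prop) _ _
    · exact Continuous.intervalIntegrable (by fun_prop) _ _
    · intro i _
      have := cF (i+1)
      exact Continuous.intervalIntegrable (by fun_prop) _ _
    · exact Continuous.intervalIntegrable (by fun_prop) _ _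
    · refine Continuous.intervalIntegrable (continuous_finsetSum _ fun i _ => ?_) _ _
      have := cF (i+1)
      fun_prop
  set A : ℕ → ℝ := fun i => ((b - a) / 2) ^ i * Gfun k a b u0 (i+1) t *
    ∫ y in a..b, (Ft k a b F i).eval y * v.eval y with hA
  have J2 : ∑ i ∈ Finset.range l, ((b - a) / 2) ^ (i+1) * Gfun k a b u0 (i+1) t *
        (∫ y in a..b, (Ft k a b F (i+1)).eval y * (derivative v).eval y) =
      ∑ i ∈ Finset.range l, A i := by
    refine Finset.sum_congr rfl fun i hi => ?_
    rw [Ft_ibp hab hF i (by have := Finset.mem_range.mp hi; omega) v hv, hA]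
    simp only [pow_succ]
    field_simp
  have J1 : Gfun k a b u0 1 t * (∫ y in a..b, (Ft k a b F 0).eval y * v.eval y) +
      ∑ i ∈ Finset.range l, ((b - a) / 2) ^ (i+1) * Gfun k a b u0 (i+2) t *
        (∫ y in a..b, (Ft k a b F (i+1)).eval y * v.eval y) = ∑ i ∈ Finset.range (l+1), A i := by
    rw [Finset.sum_range_succ', add_comm]
    simp [hA]
  rw [I1, I2, J1, J2, Finset.sum_range_succ]
  simp [hA]

/-- `|a_j(u - u_I^l, v)| ≤ C h^{k+l+1} M_{k+l+2} ∫_{τ_j} |v|`,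
with `C` depending only on `k`, `l` and the quasi-uniformity constant `c`. -/
theorem stmt10 (k l : ℕ) (hk : 1 ≤ k) (hl1 : 1 ≤ l) (hlk : l ≤ k)
    (c : ℝ) (hc : 1 ≤ c) :
    ∃ C : ℝ, 0 < C ∧
      ∀ (N : ℕ) (x : ℕ → ℝ) (h T : ℝ), 1 ≤ N → x 0 = 0 → x N = 2 * Real.pi →
        (∀ j < N, x j < x (j+1)) →
        (∀ j ∈ Finset.Icc 1 N, x j - x (j-1) ≤ h) →
        (∀ j ∈ Finset.Icc 1 N, h ≤ c * (x j - x (j-1))) →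
        0 < T →
        ∀ u0 : ℝ → ℝ, ContDiff ℝ (k+l+2) u0 →
        ∀ M : ℝ,
          (∀ i ≤ k+l+2, ∀ y ∈ Set.Icc (-T) (2 * Real.pi), |iteratedDeriv i u0 y| ≤ M) →
        ∀ P : ℕ → ℝ → Polynomial ℝ,
          (∀ j ∈ Finset.Icc 1 N, ∀ t : ℝ,
            IsGRProj k (x (j-1)) (x j) (fun y => u0 (y - t)) (P j t)) →
        ∀ F : ℕ → ℕ → Polynomial ℝ,
          (∀ j ∈ Finset.Icc 1 N, IsFSeq k (x (j-1)) (x j) (F j)) →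
        ∀ j ∈ Finset.Icc 1 N, ∀ t ∈ Set.Icc (0:ℝ) T,
        ∀ v : Polynomial ℝ, v.natDegree ≤ k →
          |(∫ y in (x (j-1))..(x j), deriv (fun s => errFun k l x u0 P F j y s) t * v.eval y)
            - (∫ y in (x (j-1))..(x j), errFun k l x u0 P F j y t * v.derivative.eval y)
            + errFun k l x u0 P F j (x j) t * v.eval (x j)
            - (if j = 1 then 0 else errFun k l x u0 P F (j-1) (x (j-1)) t) * v.eval (x (j-1))|
          ≤ C * h^(k+l+1) * M * ∫ y in (x (j-1))..(x j), |v.eval y| := by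
  obtain ⟨B, hB1, hB⟩ := legC_bound k
  have hA0 := sumOdd_nonneg k
  have hA1 := sumOdd_nonneg (k+1)
  have hB0 : 0 < B := by linarith
  refine ⟨(1 + sumOdd (k+1) * B) * (B * (2 * (2 * sumOdd k * B * B + B)) ^ l), by positivity, ?_⟩
  intro N x h T hN hx0 hxN hx hh _ hT u0 hu M hM P hP F hF j hj t ht v hv
  have hu' : ContDiff ℝ ((k+l+2 : ℕ)) u0 := by exact_mod_cast hu
  have hlt : ∀ j ∈ Finset.Icc 1 N, x (j-1) < x j := by
    intro j hj
    rw [Finset.mem_Icc] at hj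
    have := hx (j-1) (by omega)
    rwa [Nat.sub_add_cancel hj.1] at this
  have hmono : ∀ d i, i + d ≤ N → x i ≤ x (i+d) := by
    intro d
    induction d with
    | zero => intro i _; exact le_rfl
    | succ d ih =>
      intro i hi
      exact (ih i (by omega)).trans (hx (i+d) (by omega)).le
  have hab := hlt j hj
  have hj' := Finset.mem_Icc.mp hj
  have ha0 : 0 ≤ x (j-1) := by
    have := hmono (j-1) 0 (by omega)
    rwa [hx0, zero_add] at this
  have hbN : x j ≤ 2 * Real.pi := by
    have := hmono (N-j) j (by omega)
    rwa [show j + (N-j) = N by omega, hxN] at this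
  have e1 : errFun k l x u0 P F j (x j) t = 0 := err_b hab hlk (hP j hj) (hF j hj) t
  have e2 : (if j = 1 then 0 else errFun k l x u0 P F (j-1) (x (j-1)) t) = 0 := by
    split_ifs with h1
    · rfl
    · have hj1 : j - 1 ∈ Finset.Icc 1 N := Finset.mem_Icc.mpr ⟨by omega, by omega⟩
      exact err_b (hlt _ hj1) hlk (hP _ hj1) (hF _ hj1) t
  have e3 := err_main (u0 := u0) hab hk hlk hu' (hP j hj) (hF j hj) t v hv
  rw [e1, e2]
  unfold errFun
  rw [e3, zero_mul, zero_mul, add_zero, sub_zero]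
  have b1 := Gfun_bound (k := k) (l := l) (t := t) (M := M) hab hu' (fun y hy =>
    hM _ le_rfl y ⟨by linarith [hy.1, ht.2], by linarith [hy.2, ht.1]⟩)
    (fun m hm => hB m hm _ _ hab)
  have b2 := Ft_bound hab (hF j hj) hB1 (fun m hm => hB m hm _ _ hab) l
  set S := B * (2 * (2 * sumOdd k * B * B + B)) ^ l with hS
  have hS0 : 0 ≤ S := by positivity
  have cF := (Ft k (x (j-1)) (x j) (F j) l).continuous
  have cv := v.continuous
  have b3 : |∫ y in (x (j-1))..(x j), (Ft k (x (j-1)) (x j) (F j) l).eval y * v.eval y| ≤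
      S * ∫ y in (x (j-1))..(x j), |v.eval y| := by
    refine (intervalIntegral.abs_integral_le_integral_abs hab.le).trans ?_
    rw [← intervalIntegral.integral_const_mul]
    refine intervalIntegral.integral_mono_on hab.le
      (Continuous.intervalIntegrable (by fun_prop) _ _)
      (Continuous.intervalIntegrable (by fun_prop) _ _) fun y hy => ?_
    rw [abs_mul]
    exact mul_le_mul_of_nonneg_right (b2 y hy) (abs_nonneg _)
  have hI0 : 0 ≤ ∫ y in (x (j-1))..(x j), |v.eval y| :=
    intervalIntegral.integral_nonneg hab.le fun _ _ => abs_nonneg _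
  have hM0 : 0 ≤ M := (abs_nonneg _).trans
    (hM 0 (by omega) (2 * Real.pi) ⟨by linarith [Real.pi_pos], le_rfl⟩)
  have hH0 : 0 < x j - x (j-1) := by linarith
  have hHh := hh j hj
  have b4 : ((x j - x (j-1)) / 2) ^ l ≤ h ^ l := by
    gcongr
    linarith
  have b5 : (x j - x (j-1)) ^ (k+1) ≤ h ^ (k+1) := by
    gcongr
  have hh0 : 0 < h := by linarith
  rw [abs_mul, abs_mul, abs_of_nonneg (by positivity : 0 ≤ ((x j - x (j-1)) / 2) ^ l)]
  calc _ ≤ h ^ l * ((1 + sumOdd (k+1) * B) * (M * h ^ (k+1))) *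
        (S * ∫ y in (x (j-1))..(x j), |v.eval y|) := by
        refine mul_le_mul (mul_le_mul b4 (b1.trans ?_) (abs_nonneg _) (by positivity)) b3
          (abs_nonneg _) (by positivity)
        gcongr
    _ = _ := by ring
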